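/- For every x_i ∈ ℝ³ with ‖x_i‖ = 1, the exterior surface Neumann Green's function G_s(·; x_i) is harmonic on the open exterior {x ∈ ℝ³ : ‖x‖ > 1} of the unit sphere. (In particular, the function x ↦ log(1 + 2/(‖x − x_i‖ + ‖x‖ − 1)), which is the Newtonian potential of the segment joining the origin to x_i, is harmonic there.) -/

import Mathlib

open Real Filter Topology

/-- Partial derivative of `f` in the `i`-th coordinate direction. -/
noncomputable def pd (f : EuclideanSpace ℝ (Fin 3) → ℝ) (i : Fin 3)
    (x : EuclideanSpace ℝ (Fin 3)) : ℝ :=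
  fderiv ℝ f x (EuclideanSpace.single i 1)

/-- The Euclidean Laplacian: sum of the three second partial derivatives. -/
noncomputable def lap (f : EuclideanSpace ℝ (Fin 3) → ℝ)
    (x : EuclideanSpace ℝ (Fin 3)) : ℝ :=
  ∑ i : Fin 3, pd (pd f i) i x

/-- The exterior surface Neumann Green's function of the unit sphere. -/
noncomputable def Gs (xi x : EuclideanSpace ℝ (Fin 3)) : ℝ :=
  1 / (2 * π * ‖x - xi‖) -
    1 / (4 * π) * Real.log (1 + 2 / (‖x - xi‖ + ‖x‖ - 1))

lemma radial_alg {r u : ℝ} (hr : r ≠ 0) :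
    r⁻¹ * 1 + u * (-(r ^ 2)⁻¹ * (r⁻¹ * u)) = r⁻¹ - u ^ 2 * r⁻¹ ^ 3 := by
  field_simp
  ring

lemma newton_alg {r u : ℝ} (hr : r ≠ 0) :
    -(r ^ 2)⁻¹ * (r⁻¹ - u ^ 2 * r⁻¹ ^ 3) + r⁻¹ * u * (2 * r⁻¹ ^ 3 * (r⁻¹ * u))
      = -r⁻¹ ^ 3 + 3 * u ^ 2 * r⁻¹ ^ 5 := by
  field_simp
  ring

/-- `f` is differentiable at `x` with `i`-th partial derivative `d`. -/
def HasPd (f : EuclideanSpace ℝ (Fin 3) → ℝ) (i : Fin 3) (d : ℝ)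
    (x : EuclideanSpace ℝ (Fin 3)) : Prop :=
  ∃ L : EuclideanSpace ℝ (Fin 3) →L[ℝ] ℝ, HasFDerivAt f L x ∧ L (EuclideanSpace.single i 1) = d

namespace HasPd

variable {f g : EuclideanSpace ℝ (Fin 3) → ℝ} {i : Fin 3} {d e : ℝ}
  {x : EuclideanSpace ℝ (Fin 3)}

lemma pd_eq (h : HasPd f i d x) : pd f i x = d := by
  obtain ⟨L, hL, rfl⟩ := h
  simp [pd, hL.fderiv]

lemma of_eq (h : HasPd f i d x) (hd : d = e) : HasPd f i e x := hd ▸ h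

lemma congr (h : HasPd f i d x) (hg : g =ᶠ[𝓝 x] f) : HasPd g i d x := by
  obtain ⟨L, hL, h⟩ := h
  exact ⟨L, hL.congr_of_eventuallyEq hg, h⟩

lemma add (h : HasPd f i d x) (h' : HasPd g i e x) :
    HasPd (fun y => f y + g y) i (d + e) x := by
  obtain ⟨L, hL, rfl⟩ := h
  obtain ⟨M, hM, rfl⟩ := h'
  exact ⟨L + M, hL.add hM, rfl⟩

lemma mul (h : HasPd f i d x) (h' : HasPd g i e x) :
    HasPd (fun y => f y * g y) i (f x * e + g x * d) x := by
  obtain ⟨L, hL, rfl⟩ := h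
  obtain ⟨M, hM, rfl⟩ := h'
  exact ⟨_, hL.mul hM, rfl⟩

lemma const_mul (c : ℝ) (h : HasPd f i d x) : HasPd (fun y => c * f y) i (c * d) x := by
  obtain ⟨L, hL, rfl⟩ := h
  exact ⟨_, hL.const_mul c, rfl⟩

lemma comp (φ : ℝ → ℝ) {φ' : ℝ} (hφ : HasDerivAt φ φ' (f x)) (h : HasPd f i d x) :
    HasPd (fun y => φ (f y)) i (φ' * d) x := by
  obtain ⟨L, hL, rfl⟩ := h
  exact ⟨_, hφ.comp_hasFDerivAt x hL, rfl⟩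

lemma coord (a : EuclideanSpace ℝ (Fin 3)) : HasPd (fun y => y i - a i) i 1 x := by
  refine ⟨EuclideanSpace.proj i, ?_, by simp⟩
  exact (EuclideanSpace.proj (𝕜 := ℝ) i).hasFDerivAt.sub_const _

lemma norm_sub {a : EuclideanSpace ℝ (Fin 3)} (hx : x - a ≠ 0) :
    HasPd (fun y => ‖y - a‖) i (‖x - a‖⁻¹ * (x i - a i)) x := by
  have h1 : HasFDerivAt (fun y => ‖y - a‖ ^ 2) _ x :=
    ((hasFDerivAt_id x).sub_const a).norm_sq
  have h2 : HasPd (fun y => ‖y - a‖ ^ 2) i (2 * (x i - a i)) x := by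
    refine ⟨_, h1, ?_⟩
    simp [EuclideanSpace.inner_single_right]
  have hp : 0 < ‖x - a‖ := norm_pos_iff.2 hx
  have h3 := comp Real.sqrt (Real.hasDerivAt_sqrt (by positivity)) h2
  have h4 : ∀ y : EuclideanSpace ℝ (Fin 3), √(‖y - a‖ ^ 2) = ‖y - a‖ :=
    fun y => Real.sqrt_sq (norm_nonneg _)
  simp only [h4] at h3
  convert h3 using 1
  field_simp

/-- Partial derivative of the components of the unit radial field. -/
lemma radial {a : EuclideanSpace ℝ (Fin 3)} (hx : x - a ≠ 0) :
    HasPd (fun y => ‖y - a‖⁻¹ * (y i - a i)) i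
      (‖x - a‖⁻¹ - (x i - a i) ^ 2 * (‖x - a‖⁻¹) ^ 3) x := by
  have hp : ‖x - a‖ ≠ 0 := norm_ne_zero_iff.2 hx
  have h1 : HasPd (fun y => ‖y - a‖⁻¹) i (-(‖x - a‖ ^ 2)⁻¹ * (‖x - a‖⁻¹ * (x i - a i))) x :=
    comp (fun t => t⁻¹) (hasDerivAt_inv hp) (norm_sub (i := i) hx)
  have h2 : HasPd (fun y => y i - a i) i 1 x := coord a
  have h3 := h1.mul h2
  have h4 := radial_alg (u := x i - a i) hp
  beta_reduce at h3
  rw [h4] at h3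
  exact h3

end HasPd

lemma lap_eq {f : EuclideanSpace ℝ (Fin 3) → ℝ} {g : Fin 3 → EuclideanSpace ℝ (Fin 3) → ℝ}
    {h : Fin 3 → ℝ} {x : EuclideanSpace ℝ (Fin 3)}
    (hf : ∀ i, ∀ᶠ y in 𝓝 x, HasPd f i (g i y) y) (hg : ∀ i, HasPd (g i) i (h i) x) :
    lap f x = ∑ i, h i := by
  refine Finset.sum_congr rfl fun i _ => ?_
  exact ((hg i).congr ((hf i).mono fun y hy => hy.pd_eq)).pd_eq

lemma norm_sq_coord (a x : EuclideanSpace ℝ (Fin 3)) :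
    (x 0 - a 0) ^ 2 + (x 1 - a 1) ^ 2 + (x 2 - a 2) ^ 2 = ‖x - a‖ ^ 2 := by
  simp [EuclideanSpace.norm_sq_eq, Fin.sum_univ_three]

section
variable {xi x : EuclideanSpace ℝ (Fin 3)}

lemma sub_ne (hxi : ‖xi‖ = 1) (hx : 1 < ‖x‖) : x - xi ≠ 0 := by
  intro h
  rw [sub_eq_zero.1 h] at hx
  linarith

lemma eventually_ext (hx : 1 < ‖x‖) : ∀ᶠ y in 𝓝 x, 1 < ‖y‖ :=
  (isOpen_lt continuous_const continuous_norm).mem_nhds hx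

/-- gradient component of `1 / r` -/
lemma pd_newton (i : Fin 3) (hxi : ‖xi‖ = 1) (hx : 1 < ‖x‖) :
    HasPd (fun y => ‖y - xi‖⁻¹) i
      (-((‖x - xi‖ ^ 2)⁻¹) * (‖x - xi‖⁻¹ * (x i - xi i))) x :=
  HasPd.comp (fun t => t⁻¹) (hasDerivAt_inv (norm_ne_zero_iff.2 (sub_ne hxi hx))) (HasPd.norm_sub (sub_ne hxi hx))

lemma pd2_newton (i : Fin 3) (hxi : ‖xi‖ = 1) (hx : 1 < ‖x‖) :
    HasPd (fun y => -((‖y - xi‖ ^ 2)⁻¹) * (‖y - xi‖⁻¹ * (y i - xi i))) i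
      (-(‖x - xi‖⁻¹) ^ 3 + 3 * (x i - xi i) ^ 2 * (‖x - xi‖⁻¹) ^ 5) x := by
  have hp := norm_ne_zero_iff.2 (sub_ne hxi hx)
  have h1 : HasDerivAt (fun t : ℝ => -((t ^ 2)⁻¹)) (2 * (‖x - xi‖⁻¹) ^ 3) ‖x - xi‖ := by
    refine ((hasDerivAt_pow 2 ‖x - xi‖).fun_inv (pow_ne_zero 2 hp)).fun_neg.congr_deriv ?_
    push_cast
    field_simp
  have h3 : HasPd (fun y => -((‖y - xi‖ ^ 2)⁻¹)) i
      (2 * (‖x - xi‖⁻¹) ^ 3 * (‖x - xi‖⁻¹ * (x i - xi i))) x :=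
    HasPd.comp (fun t => -((t ^ 2)⁻¹)) h1 (HasPd.norm_sub (i := i) (sub_ne hxi hx))
  have h4 := HasPd.radial (i := i) (sub_ne hxi hx)
  have h2 := h3.mul h4
  beta_reduce at h2
  rw [newton_alg hp] at h2
  exact h2

lemma sum_newton (hxi : ‖xi‖ = 1) (hx : 1 < ‖x‖) :
    ∑ i, (-(‖x - xi‖⁻¹) ^ 3 + 3 * (x i - xi i) ^ 2 * (‖x - xi‖⁻¹) ^ 5) = 0 := by
  have hp := norm_ne_zero_iff.2 (sub_ne hxi hx)
  have h := norm_sq_coord xi x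
  rw [Fin.sum_univ_three]
  have : ‖x - xi‖ ^ 2 * (‖x - xi‖⁻¹) ^ 5 = (‖x - xi‖⁻¹) ^ 3 := by field_simp
  linear_combination 3 * (‖x - xi‖⁻¹) ^ 5 * h + 3 * this

/-- derivative of the profile `log (1 + 2 / (w - 1))` -/
lemma deriv_profile {w : ℝ} (hw : 1 < w) :
    HasDerivAt (fun t : ℝ => Real.log (1 + 2 / (t - 1))) (-2 * (w ^ 2 - 1)⁻¹) w := by
  have h0 : w - 1 ≠ 0 := by linarith
  have h1 : 0 < 1 + 2 / (w - 1) := by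
    have : 0 < w - 1 := by linarith
    positivity
  have h2 : w ^ 2 - 1 ≠ 0 := by nlinarith
  have h3 : w + 1 ≠ 0 := by linarith
  have h := ((((hasDerivAt_id' w).sub_const 1).fun_inv h0).const_mul 2).const_add 1 |>.log
    (by simpa [div_eq_mul_inv] using h1.ne')
  have h5 : w ^ 2 - 1 = (w - 1) * (w + 1) := by ring
  have h6 : 1 + 2 * (w - 1)⁻¹ = (w + 1) * (w - 1)⁻¹ := by field_simp; ring
  refine h.congr_deriv ?_
  rw [h6, h5]
  field_simp

lemma deriv_profile2 {w : ℝ} (hw : 1 < w) :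
    HasDerivAt (fun t : ℝ => -2 * (t ^ 2 - 1)⁻¹) (4 * w * ((w ^ 2 - 1)⁻¹) ^ 2) w := by
  have h2 : w ^ 2 - 1 ≠ 0 := by nlinarith
  refine ((((hasDerivAt_pow 2 w).sub_const 1).fun_inv h2).const_mul (-2)).congr_deriv ?_
  push_cast
  field_simp
  norm_num

lemma w_gt (xi : EuclideanSpace ℝ (Fin 3)) (hx : 1 < ‖x‖) : 1 < ‖x - xi‖ + ‖x‖ := by
  have := norm_nonneg (x - xi)
  linarith

lemma ne_zero_ext (hx : 1 < ‖x‖) : x - 0 ≠ 0 := by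
  rw [sub_zero]
  exact norm_pos_iff.1 (by linarith)

lemma pd_w (i : Fin 3) (hxi : ‖xi‖ = 1) (hx : 1 < ‖x‖) :
    HasPd (fun y => ‖y - xi‖ + ‖y‖) i (‖x - xi‖⁻¹ * (x i - xi i) + ‖x‖⁻¹ * x i) x := by
  simpa using (HasPd.norm_sub (i := i) (sub_ne hxi hx)).add
    (HasPd.norm_sub (i := i) (ne_zero_ext hx))

lemma pd2_w (i : Fin 3) (hxi : ‖xi‖ = 1) (hx : 1 < ‖x‖) :
    HasPd (fun y => ‖y - xi‖⁻¹ * (y i - xi i) + ‖y‖⁻¹ * y i) i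
      (‖x - xi‖⁻¹ - (x i - xi i) ^ 2 * (‖x - xi‖⁻¹) ^ 3 + (‖x‖⁻¹ - x i ^ 2 * (‖x‖⁻¹) ^ 3)) x := by
  simpa using (HasPd.radial (i := i) (sub_ne hxi hx)).add
    (HasPd.radial (i := i) (ne_zero_ext hx))

lemma pd_log (i : Fin 3) (hxi : ‖xi‖ = 1) (hx : 1 < ‖x‖) :
    HasPd (fun y => Real.log (1 + 2 / (‖y - xi‖ + ‖y‖ - 1))) i
      (-2 * ((‖x - xi‖ + ‖x‖) ^ 2 - 1)⁻¹ *
        (‖x - xi‖⁻¹ * (x i - xi i) + ‖x‖⁻¹ * x i)) x :=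
  HasPd.comp (fun t : ℝ => Real.log (1 + 2 / (t - 1))) (deriv_profile (w_gt xi hx)) (pd_w i hxi hx)

lemma pd2_log (i : Fin 3) (hxi : ‖xi‖ = 1) (hx : 1 < ‖x‖) :
    HasPd (fun x => -2 * ((‖x - xi‖ + ‖x‖) ^ 2 - 1)⁻¹ *
        (‖x - xi‖⁻¹ * (x i - xi i) + ‖x‖⁻¹ * x i)) i
      (-2 * ((‖x - xi‖ + ‖x‖) ^ 2 - 1)⁻¹ * (‖x - xi‖⁻¹ - (x i - xi i) ^ 2 * (‖x - xi‖⁻¹) ^ 3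
          + (‖x‖⁻¹ - x i ^ 2 * (‖x‖⁻¹) ^ 3))
        + (‖x - xi‖⁻¹ * (x i - xi i) + ‖x‖⁻¹ * x i) *
          (4 * (‖x - xi‖ + ‖x‖) * (((‖x - xi‖ + ‖x‖) ^ 2 - 1)⁻¹) ^ 2 *
            (‖x - xi‖⁻¹ * (x i - xi i) + ‖x‖⁻¹ * x i))) x :=
  (HasPd.comp (fun t : ℝ => -2 * (t ^ 2 - 1)⁻¹) (deriv_profile2 (w_gt xi hx)) (pd_w i hxi hx)).mul (pd2_w i hxi hx)

lemma sum_log (hxi : ‖xi‖ = 1) (hx : 1 < ‖x‖) :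
    ∑ i, (-2 * ((‖x - xi‖ + ‖x‖) ^ 2 - 1)⁻¹ *
        (‖x - xi‖⁻¹ - (x i - xi i) ^ 2 * (‖x - xi‖⁻¹) ^ 3 + (‖x‖⁻¹ - x i ^ 2 * (‖x‖⁻¹) ^ 3))
        + (‖x - xi‖⁻¹ * (x i - xi i) + ‖x‖⁻¹ * x i) *
          (4 * (‖x - xi‖ + ‖x‖) * (((‖x - xi‖ + ‖x‖) ^ 2 - 1)⁻¹) ^ 2 *
            (‖x - xi‖⁻¹ * (x i - xi i) + ‖x‖⁻¹ * x i))) = 0 := by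
  have hr := norm_ne_zero_iff.2 (sub_ne hxi hx)
  have hs : ‖x‖ ≠ 0 := by linarith
  have hw : (‖x - xi‖ + ‖x‖) ^ 2 - 1 ≠ 0 := by nlinarith [w_gt xi hx]
  have h1 := norm_sq_coord xi x
  have h2 := norm_sq_coord 0 x
  have h3 := norm_sq_coord 0 xi
  simp only [sub_zero, hxi, PiLp.zero_apply] at h2 h3
  rw [Fin.sum_univ_three]
  generalize ‖x - xi‖ = r at *
  generalize ‖x‖ = s at *
  generalize x 0 = x0 at *
  generalize x 1 = x1 at *
  generalize x 2 = x2 at *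
  generalize xi 0 = a0 at *
  generalize xi 1 = a1 at *
  generalize xi 2 = a2 at *
  have hq : (r⁻¹ * (x0 - a0) + s⁻¹ * x0) ^ 2 + (r⁻¹ * (x1 - a1) + s⁻¹ * x1) ^ 2
      + (r⁻¹ * (x2 - a2) + s⁻¹ * x2) ^ 2 = ((r + s) ^ 2 - 1) * (r⁻¹ * s⁻¹) := by
    field_simp
    linear_combination (s ^ 2 + r * s) * h1 + (r ^ 2 + r * s) * h2 - r * s * h3
  have ht : (r⁻¹ - (x0 - a0) ^ 2 * r⁻¹ ^ 3 + (s⁻¹ - x0 ^ 2 * s⁻¹ ^ 3))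
      + (r⁻¹ - (x1 - a1) ^ 2 * r⁻¹ ^ 3 + (s⁻¹ - x1 ^ 2 * s⁻¹ ^ 3))
      + (r⁻¹ - (x2 - a2) ^ 2 * r⁻¹ ^ 3 + (s⁻¹ - x2 ^ 2 * s⁻¹ ^ 3))
      = 2 * (r + s) * (r⁻¹ * s⁻¹) := by
    have e1 : r ^ 2 * r⁻¹ ^ 3 = r⁻¹ := by field_simp
    have e2 : s ^ 2 * s⁻¹ ^ 3 = s⁻¹ := by field_simp
    have e3 : (r + s) * (r⁻¹ * s⁻¹) = r⁻¹ + s⁻¹ := by field_simp; ring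
    linear_combination (-r⁻¹ ^ 3) * h1 - s⁻¹ ^ 3 * h2 - e1 - e2 - 2 * e3
  have hk : ((r + s) ^ 2 - 1)⁻¹ * ((r + s) ^ 2 - 1) = 1 := inv_mul_cancel₀ hw
  generalize ((r + s) ^ 2 - 1)⁻¹ = k at *
  linear_combination (-2 * k) * ht + 4 * (r + s) * k ^ 2 * hq
    + 4 * (r + s) * k * (r⁻¹ * s⁻¹) * hk

lemma contDiffAt_log (hxi : ‖xi‖ = 1) (hx : 1 < ‖x‖) :
    ContDiffAt ℝ 2 (fun x => Real.log (1 + 2 / (‖x - xi‖ + ‖x‖ - 1))) x := by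
  have hw := w_gt xi hx
  have hw' : 0 < ‖x - xi‖ + ‖x‖ - 1 := by linarith
  have h1 : ContDiffAt ℝ 2 (fun y => ‖y - xi‖) x :=
    (contDiffAt_id.sub contDiffAt_const).norm ℝ (sub_ne hxi hx)
  have h2 : ContDiffAt ℝ 2 (fun y : EuclideanSpace ℝ (Fin 3) => ‖y‖) x :=
    contDiffAt_id.norm ℝ (norm_pos_iff.1 (by simpa using (by linarith : 0 < ‖x‖)))
  refine ContDiffAt.log (contDiffAt_const.add (contDiffAt_const.div
    ((h1.add h2).sub contDiffAt_const) hw'.ne')) ?_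
  positivity

lemma contDiffAt_Gs (hxi : ‖xi‖ = 1) (hx : 1 < ‖x‖) : ContDiffAt ℝ 2 (Gs xi) x := by
  have hp := norm_ne_zero_iff.2 (sub_ne hxi hx)
  have h1 : ContDiffAt ℝ 2 (fun y => ‖y - xi‖) x :=
    (contDiffAt_id.sub contDiffAt_const).norm ℝ (sub_ne hxi hx)
  refine (contDiffAt_const.div (contDiffAt_const.mul h1) ?_).sub
    (contDiffAt_const.mul (contDiffAt_log hxi hx))
  have := Real.pi_ne_zero
  positivity

end

/-- For `‖x_i‖ = 1`, the exterior surface Neumann Green's function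
`G_s(·;x_i)` is harmonic on the open exterior of the unit sphere; in
particular the logarithmic term (Newtonian potential of the segment from the
origin to `x_i`) is harmonic there. -/
theorem stmt9 (xi : EuclideanSpace ℝ (Fin 3)) (hxi : ‖xi‖ = 1) :
    (ContDiffOn ℝ 2 (Gs xi) {x : EuclideanSpace ℝ (Fin 3) | 1 < ‖x‖} ∧
      ∀ x : EuclideanSpace ℝ (Fin 3), 1 < ‖x‖ → lap (Gs xi) x = 0) ∧
    (ContDiffOn ℝ 2
        (fun x : EuclideanSpace ℝ (Fin 3) =>
          Real.log (1 + 2 / (‖x - xi‖ + ‖x‖ - 1)))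
        {x : EuclideanSpace ℝ (Fin 3) | 1 < ‖x‖} ∧
      ∀ x : EuclideanSpace ℝ (Fin 3), 1 < ‖x‖ →
        lap (fun x => Real.log (1 + 2 / (‖x - xi‖ + ‖x‖ - 1))) x = 0) := by
  refine ⟨⟨fun x hx => (contDiffAt_Gs hxi hx).contDiffWithinAt, fun x hx => ?_⟩,
    fun x hx => (contDiffAt_log hxi hx).contDiffWithinAt, fun x hx => ?_⟩
  · have hG : Gs xi = fun y => 1 / (2 * π) * ‖y - xi‖⁻¹ +
        -(1 / (4 * π)) * Real.log (1 + 2 / (‖y - xi‖ + ‖y‖ - 1)) := by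
      funext y
      simp only [Gs, one_div, mul_inv]
      ring
    rw [hG, lap_eq (fun i => (eventually_ext hx).mono fun y hy =>
        ((pd_newton i hxi hy).const_mul _).add ((pd_log i hxi hy).const_mul _))
      (fun i => ((pd2_newton i hxi hx).const_mul _).add ((pd2_log i hxi hx).const_mul _)),
      Finset.sum_add_distrib, ← Finset.mul_sum, ← Finset.mul_sum, sum_newton hxi hx,
      sum_log hxi hx]
    simp
  · rw [lap_eq (fun i => (eventually_ext hx).mono fun y hy => pd_log i hxi hy)
      (fun i => pd2_log i hxi hx), sum_log hxi hx]
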